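/- arXiv:math/0603741 — 10 statements merged into one kernel-verified Lean document; each statement's English description precedes it below -/
import Mathlib

section
/- Fix ε > 0. The value function v_ε(y) = f(y,x) for x ∈ S_ε(y) is well defined (f(y,x) = f(y,x') for all x, x' ∈ S_ε(y)) and sequentially continuous: if y_k → y, x_k ∈ S_ε(y_k) and x ∈ S_ε(y), then f(y_k, x_k) → f(y, x). -/
open Filter Topology

/-- `S_ε(y) = argmin {h(y,z) + ε f(y,z)² : z ∈ C}`. -/
def Seps {n m : ℕ} (C : Set (EuclideanSpace ℝ (Fin m)))
    (f h : EuclideanSpace ℝ (Fin n) → EuclideanSpace ℝ (Fin m) → ℝ)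
    (ε : ℝ) (y : EuclideanSpace ℝ (Fin n)) : Set (EuclideanSpace ℝ (Fin m)) :=
  {x | x ∈ C ∧ ∀ z ∈ C, h y x + ε * (f y x) ^ 2 ≤ h y z + ε * (f y z) ^ 2}

/-- The function `f y` is constant on the set of minimisers `Seps C f h ε y`. -/
theorem Seps.eq_of_mem {n m : ℕ} {C : Set (EuclideanSpace ℝ (Fin m))} (hC : Convex ℝ C)
    {f h : EuclideanSpace ℝ (Fin n) → EuclideanSpace ℝ (Fin m) → ℝ}
    {y : EuclideanSpace ℝ (Fin n)} (hfpos : ∀ x, 0 ≤ f y x)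
    (hfconv : ConvexOn ℝ Set.univ (f y)) (hhconv : ConvexOn ℝ Set.univ (h y))
    {ε : ℝ} (hε : 0 < ε) {x x' : EuclideanSpace ℝ (Fin m)}
    (hx : x ∈ Seps C f h ε y) (hx' : x' ∈ Seps C f h ε y) : f y x = f y x' := by
  have half_nonneg : (0 : ℝ) ≤ 1 / 2 := by norm_num
  have half_add : (1 / 2 : ℝ) + 1 / 2 = 1 := by norm_num
  have hzC := hC hx.1 hx'.1 half_nonneg half_nonneg half_add
  have hfz := hfconv.2 (Set.mem_univ x) (Set.mem_univ x') half_nonneg half_nonneg half_add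
  have hhz := hhconv.2 (Set.mem_univ x) (Set.mem_univ x') half_nonneg half_nonneg half_add
  have hxz := hx.2 _ hzC
  have hxz' := hx'.2 _ hzC
  have hpos := hfpos ((1 / 2 : ℝ) • x + (1 / 2 : ℝ) • x')
  simp only [smul_eq_mul] at hfz hhz
  have hsq := mul_le_mul_of_nonneg_left (pow_le_pow_left₀ hpos hfz 2) hε.le
  have hle : ε * (f y x - f y x') ^ 2 ≤ 0 := by nlinarith
  have hzero : (f y x - f y x') ^ 2 = 0 :=
    le_antisymm (nonpos_of_mul_nonpos_right hle hε) (sq_nonneg _)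
  exact sub_eq_zero.mp (pow_eq_zero_iff two_ne_zero |>.mp hzero)

/-- The set-valued map `Seps C f h ε` has a closed graph when `C` is closed. -/
theorem Seps.mem_of_tendsto {n m : ℕ} {C : Set (EuclideanSpace ℝ (Fin m))} (hC : IsClosed C)
    {f h : EuclideanSpace ℝ (Fin n) → EuclideanSpace ℝ (Fin m) → ℝ}
    (hf : Continuous fun p : EuclideanSpace ℝ (Fin n) × EuclideanSpace ℝ (Fin m) => f p.1 p.2)
    (hh : Continuous fun p : EuclideanSpace ℝ (Fin n) × EuclideanSpace ℝ (Fin m) => h p.1 p.2)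
    {ε : ℝ} {ι : Type*} {l : Filter ι} [l.NeBot]
    {u : ι → EuclideanSpace ℝ (Fin n)} {y : EuclideanSpace ℝ (Fin n)}
    {w : ι → EuclideanSpace ℝ (Fin m)} {x : EuclideanSpace ℝ (Fin m)}
    (hu : Tendsto u l (𝓝 y)) (hw : Tendsto w l (𝓝 x)) (hmem : ∀ i, w i ∈ Seps C f h ε (u i)) :
    x ∈ Seps C f h ε y := by
  refine ⟨hC.mem_of_tendsto hw (Eventually.of_forall fun i => (hmem i).1), fun z hz => ?_⟩
  have hF : Continuous fun p : EuclideanSpace ℝ (Fin n) × EuclideanSpace ℝ (Fin m) =>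
      h p.1 p.2 + ε * f p.1 p.2 ^ 2 := hh.add (continuous_const.mul (hf.pow 2))
  exact le_of_tendsto_of_tendsto' ((hF.tendsto (y, x)).comp (hu.prodMk_nhds hw))
    ((hF.tendsto (y, z)).comp (hu.prodMk_nhds tendsto_const_nhds)) fun i => (hmem i).2 z hz

theorem stmt2 {n m : ℕ} (C : Set (EuclideanSpace ℝ (Fin m)))
    (hCne : C.Nonempty) (hCconv : Convex ℝ C) (hCcomp : IsCompact C)
    (f h : EuclideanSpace ℝ (Fin n) → EuclideanSpace ℝ (Fin m) → ℝ)
    (hf : Continuous fun p : EuclideanSpace ℝ (Fin n) × EuclideanSpace ℝ (Fin m) => f p.1 p.2)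
    (hh : Continuous fun p : EuclideanSpace ℝ (Fin n) × EuclideanSpace ℝ (Fin m) => h p.1 p.2)
    (hfpos : ∀ y x, 0 ≤ f y x)
    (hfconv : ∀ y, ConvexOn ℝ Set.univ (f y))
    (hhconv : ∀ y, ConvexOn ℝ Set.univ (h y))
    (ε : ℝ) (hε : 0 < ε) :
    (∀ (y : EuclideanSpace ℝ (Fin n)) (x x' : EuclideanSpace ℝ (Fin m)),
      x ∈ Seps C f h ε y → x' ∈ Seps C f h ε y → f y x = f y x') ∧
    (∀ (yk : ℕ → EuclideanSpace ℝ (Fin n)) (y : EuclideanSpace ℝ (Fin n))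
       (xk : ℕ → EuclideanSpace ℝ (Fin m)) (x : EuclideanSpace ℝ (Fin m)),
      Tendsto yk atTop (𝓝 y) → (∀ k, xk k ∈ Seps C f h ε (yk k)) → x ∈ Seps C f h ε y →
      Tendsto (fun k => f (yk k) (xk k)) atTop (𝓝 (f y x))) := by
  have heq : ∀ (y : EuclideanSpace ℝ (Fin n)) (x x' : EuclideanSpace ℝ (Fin m)),
      x ∈ Seps C f h ε y → x' ∈ Seps C f h ε y → f y x = f y x' := fun y _ _ hx hx' =>
    Seps.eq_of_mem hCconv (hfpos y) (hfconv y) (hhconv y) hε hx hx'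
  refine ⟨heq, fun yk y xk x hy hxk hx => tendsto_of_subseq_tendsto fun ns hns => ?_⟩
  obtain ⟨a, -, φ, hφ, ha⟩ := hCcomp.tendsto_subseq fun j => (hxk (ns j)).1
  have hyφ : Tendsto (fun j => yk (ns (φ j))) atTop (𝓝 y) :=
    hy.comp (hns.comp hφ.tendsto_atTop)
  have haS : a ∈ Seps C f h ε y :=
    Seps.mem_of_tendsto hCcomp.isClosed hf hh hyφ ha fun j => hxk (ns (φ j))
  rw [heq y x a hx haS]
  exact ⟨φ, (hf.tendsto (y, a)).comp (hyφ.prodMk_nhds ha)⟩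
end

section
/- For every ε > 0 the penalized bilevel problem (P_ε) has an optimal solution: there exist y_ε ∈ K and x_ε ∈ S_ε(y_ε) such that f(y, x) ≤ f(y_ε, x_ε) for every y ∈ K and every x ∈ S_ε(y). -/
open Filter Topology

/-- The graph of the argmin map of a jointly continuous function over a fixed set, restricted to
a compact set of parameters, is compact. -/
theorem isCompact_graph_argmin {Y X : Type*} [TopologicalSpace Y] [TopologicalSpace X]
    {K : Set Y} {C : Set X} (hK : IsCompact K) (hC : IsCompact C) {g : Y → X → ℝ}
    (hg : Continuous fun p : Y × X => g p.1 p.2) :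
    IsCompact {p : Y × X | p ∈ K ×ˢ C ∧ ∀ z ∈ C, g p.1 p.2 ≤ g p.1 z} := by
  have hclosed : IsClosed {p : Y × X | ∀ z ∈ C, g p.1 p.2 ≤ g p.1 z} := by
    simp only [Set.ofPred_forall]
    refine isClosed_biInter fun z _ => isClosed_le hg ?_
    exact hg.comp (continuous_fst.prodMk continuous_const)
  exact (hK.prod hC).inter_right hclosed

theorem stmt3 {n m : ℕ} (K : Set (EuclideanSpace ℝ (Fin n))) (C : Set (EuclideanSpace ℝ (Fin m)))
    (hKne : K.Nonempty) (hKconv : Convex ℝ K) (hKcomp : IsCompact K)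
    (hCne : C.Nonempty) (hCconv : Convex ℝ C) (hCcomp : IsCompact C)
    (f h : EuclideanSpace ℝ (Fin n) → EuclideanSpace ℝ (Fin m) → ℝ)
    (hf : Continuous fun p : EuclideanSpace ℝ (Fin n) × EuclideanSpace ℝ (Fin m) => f p.1 p.2)
    (hh : Continuous fun p : EuclideanSpace ℝ (Fin n) × EuclideanSpace ℝ (Fin m) => h p.1 p.2)
    (hfpos : ∀ y x, 0 ≤ f y x)
    (hfconv : ∀ y ∈ K, ConvexOn ℝ Set.univ (f y))
    (hhconv : ∀ y ∈ K, ConvexOn ℝ Set.univ (h y))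
    (ε : ℝ) (hε : 0 < ε) :
    ∃ yε ∈ K, ∃ xε ∈ Seps C f h ε yε,
      ∀ y ∈ K, ∀ x ∈ Seps C f h ε y, f y x ≤ f yε xε := by
  have hg : Continuous fun p : EuclideanSpace ℝ (Fin n) × EuclideanSpace ℝ (Fin m) =>
      h p.1 p.2 + ε * (f p.1 p.2) ^ 2 := hh.add (continuous_const.mul (hf.pow 2))
  obtain ⟨y₀, hy₀⟩ := hKne
  obtain ⟨x₀, hx₀, hmin⟩ := hCcomp.exists_isMinOn hCne
    (hg.comp (Continuous.prodMk_right y₀)).continuousOn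
  obtain ⟨⟨y, x⟩, ⟨⟨hy, hx⟩, hyx⟩, hmax⟩ :=
    (isCompact_graph_argmin (g := fun y x => h y x + ε * (f y x) ^ 2) hKcomp hCcomp
      hg).exists_isMaxOn ⟨(y₀, x₀), ⟨hy₀, hx₀⟩, fun z hz => hmin hz⟩ hf.continuousOn
  exact ⟨y, hy, x, ⟨hx, hyx⟩, fun y' hy' x' hx' =>
    hmax (a := (y', x')) ⟨⟨hy', hx'.1⟩, hx'.2⟩⟩
end

section
/- Fix y ∈ ℝⁿ. If ε_k → 0 with ε_k > 0, x_k ∈ S_{ε_k}(y) for every k, and x_k → x̄, then x̄ ∈ S̃(y). -/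
open Filter Topology

/-- `S(y) = argmin {h(y,z) : z ∈ C}`. -/
def Slow {n m : ℕ} (C : Set (EuclideanSpace ℝ (Fin m)))
    (h : EuclideanSpace ℝ (Fin n) → EuclideanSpace ℝ (Fin m) → ℝ)
    (y : EuclideanSpace ℝ (Fin n)) : Set (EuclideanSpace ℝ (Fin m)) :=
  {x | x ∈ C ∧ ∀ z ∈ C, h y x ≤ h y z}

/-- `S̃(y) = argmin {f(y,z)² : z ∈ S(y)}`. -/
def Stilde {n m : ℕ} (C : Set (EuclideanSpace ℝ (Fin m)))
    (f h : EuclideanSpace ℝ (Fin n) → EuclideanSpace ℝ (Fin m) → ℝ)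
    (y : EuclideanSpace ℝ (Fin n)) : Set (EuclideanSpace ℝ (Fin m)) :=
  {x | x ∈ Slow C h y ∧ ∀ z ∈ Slow C h y, (f y x) ^ 2 ≤ (f y z) ^ 2}


theorem stmt5 {n m : ℕ} (C : Set (EuclideanSpace ℝ (Fin m)))
    (hCne : C.Nonempty) (hCconv : Convex ℝ C) (hCcomp : IsCompact C)
    (f h : EuclideanSpace ℝ (Fin n) → EuclideanSpace ℝ (Fin m) → ℝ)
    (hf : Continuous fun p : EuclideanSpace ℝ (Fin n) × EuclideanSpace ℝ (Fin m) => f p.1 p.2)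
    (hh : Continuous fun p : EuclideanSpace ℝ (Fin n) × EuclideanSpace ℝ (Fin m) => h p.1 p.2)
    (hfpos : ∀ y x, 0 ≤ f y x)
    (y : EuclideanSpace ℝ (Fin n))
    (ε : ℕ → ℝ) (hεpos : ∀ k, 0 < ε k) (hε : Tendsto ε atTop (𝓝 0))
    (xk : ℕ → EuclideanSpace ℝ (Fin m)) (hxk : ∀ k, xk k ∈ Seps C f h (ε k) y)
    (xbar : EuclideanSpace ℝ (Fin m)) (hlim : Tendsto xk atTop (𝓝 xbar)) :
    xbar ∈ Stilde C f h y := by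
  have hhy : Continuous (h y) := hh.comp (Continuous.prodMk_right y)
  have hfy : Continuous (f y) := hf.comp (Continuous.prodMk_right y)
  have hh_lim : Tendsto (fun k => h y (xk k)) atTop (𝓝 (h y xbar)) := (hhy.tendsto xbar).comp hlim
  have hf_lim : Tendsto (fun k => f y (xk k) ^ 2) atTop (𝓝 (f y xbar ^ 2)) :=
    ((hfy.tendsto xbar).comp hlim).pow 2
  have hxbar : xbar ∈ C :=
    hCcomp.isClosed.mem_of_tendsto hlim (Eventually.of_forall fun k => (hxk k).1)
  refine ⟨⟨hxbar, fun z hz => ?_⟩, fun z hz => ?_⟩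
  · have hl := hh_lim.add (hε.mul hf_lim)
    have hr := (hε.mul_const (f y z ^ 2)).const_add (h y z)
    simpa using le_of_tendsto_of_tendsto' hl hr fun k => (hxk k).2 z hz
  · refine le_of_tendsto' hf_lim fun k => le_of_mul_le_mul_left ?_ (hεpos k)
    linarith [(hxk k).2 z hz.1, hz.2 (xk k) (hxk k).1]
end

section
/- If ε_k → 0 with ε_k > 0, y_k → ȳ in ℝⁿ, x_k ∈ S_{ε_k}(y_k) for every k, and x_k → x̄, then x̄ ∈ S(ȳ). -/
open Filter Topology

theorem stmt6 {n m : ℕ} (C : Set (EuclideanSpace ℝ (Fin m)))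
    (hCne : C.Nonempty) (hCconv : Convex ℝ C) (hCcomp : IsCompact C)
    (f h : EuclideanSpace ℝ (Fin n) → EuclideanSpace ℝ (Fin m) → ℝ)
    (hf : Continuous fun p : EuclideanSpace ℝ (Fin n) × EuclideanSpace ℝ (Fin m) => f p.1 p.2)
    (hh : Continuous fun p : EuclideanSpace ℝ (Fin n) × EuclideanSpace ℝ (Fin m) => h p.1 p.2)
    (hfpos : ∀ y x, 0 ≤ f y x)
    (ε : ℕ → ℝ) (hεpos : ∀ k, 0 < ε k) (hε : Tendsto ε atTop (𝓝 0))
    (yk : ℕ → EuclideanSpace ℝ (Fin n)) (ybar : EuclideanSpace ℝ (Fin n))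
    (hyk : Tendsto yk atTop (𝓝 ybar))
    (xk : ℕ → EuclideanSpace ℝ (Fin m)) (hxk : ∀ k, xk k ∈ Seps C f h (ε k) (yk k))
    (xbar : EuclideanSpace ℝ (Fin m)) (hlim : Tendsto xk atTop (𝓝 xbar)) :
    xbar ∈ Slow C h ybar := by
  refine ⟨hCcomp.isClosed.mem_of_tendsto hlim (.of_forall fun k => (hxk k).1), fun z hz => ?_⟩
  have tendsto_objective : ∀ {u : ℕ → EuclideanSpace ℝ (Fin m)} {a : EuclideanSpace ℝ (Fin m)},
      Tendsto u atTop (𝓝 a) →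
      Tendsto (fun k => h (yk k) (u k) + ε k * f (yk k) (u k) ^ 2) atTop (𝓝 (h ybar a)) := by
    intro u a hu
    have hyu := hyk.prodMk_nhds hu
    simpa using ((hh.tendsto (ybar, a)).comp hyu).add
      (hε.mul (((hf.tendsto (ybar, a)).comp hyu).pow 2))
  exact le_of_tendsto_of_tendsto' (tendsto_objective hlim)
    (tendsto_objective tendsto_const_nhds) fun k => (hxk k).2 z hz
end

section
/- (Key lemma of Theorem 3.1.) Let ε_k → 0 with ε_k > 0, y_k → ȳ, x_k ∈ S_{ε_k}(y_k) with x_k → x̄. Assume the Hoffman-type error bound: there exists σ₀ > 0 such that for every k and every x̃ ∈ C, dist(x̃, Λ_k) ≤ max(h(y_k, x̃) − h(y_k, x_k), 0)/σ₀, where Λ_k = {x ∈ C : h(y_k, x) ≤ h(y_k, x_k)}. Then x̄ ∈ S̃(ȳ). -/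
open Filter Topology

theorem stmt7 {n m : ℕ} (C : Set (EuclideanSpace ℝ (Fin m)))
    (hCne : C.Nonempty) (hCconv : Convex ℝ C) (hCcomp : IsCompact C)
    (f h : EuclideanSpace ℝ (Fin n) → EuclideanSpace ℝ (Fin m) → ℝ)
    (hf : Continuous fun p : EuclideanSpace ℝ (Fin n) × EuclideanSpace ℝ (Fin m) => f p.1 p.2)
    (hh : Continuous fun p : EuclideanSpace ℝ (Fin n) × EuclideanSpace ℝ (Fin m) => h p.1 p.2)
    (hfpos : ∀ y x, 0 ≤ f y x)
    (ε : ℕ → ℝ) (hεpos : ∀ k, 0 < ε k) (hε : Tendsto ε atTop (𝓝 0))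
    (yk : ℕ → EuclideanSpace ℝ (Fin n)) (ybar : EuclideanSpace ℝ (Fin n))
    (hyk : Tendsto yk atTop (𝓝 ybar))
    (xk : ℕ → EuclideanSpace ℝ (Fin m)) (hxk : ∀ k, xk k ∈ Seps C f h (ε k) (yk k))
    (xbar : EuclideanSpace ℝ (Fin m)) (hlim : Tendsto xk atTop (𝓝 xbar))
    (hHoffman : ∃ σ₀ : ℝ, 0 < σ₀ ∧ ∀ k, ∀ xt ∈ C,
      Metric.infDist xt {x | x ∈ C ∧ h (yk k) x ≤ h (yk k) (xk k)} ≤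
        max (h (yk k) xt - h (yk k) (xk k)) 0 / σ₀) :
    xbar ∈ Stilde C f h ybar := by
  have hhx : Tendsto (fun k => h (yk k) (xk k)) atTop (𝓝 (h ybar xbar)) :=
    (hh.tendsto (ybar, xbar)).comp (hyk.prodMk_nhds hlim)
  have hfx : Tendsto (fun k => f (yk k) (xk k)) atTop (𝓝 (f ybar xbar)) :=
    (hf.tendsto (ybar, xbar)).comp (hyk.prodMk_nhds hlim)
  have hhz (z) : Tendsto (fun k => h (yk k) z) atTop (𝓝 (h ybar z)) :=
    (hh.tendsto (ybar, z)).comp (hyk.prodMk_nhds tendsto_const_nhds)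
  have hfz (z) : Tendsto (fun k => f (yk k) z) atTop (𝓝 (f ybar z)) :=
    (hf.tendsto (ybar, z)).comp (hyk.prodMk_nhds tendsto_const_nhds)
  have hxbarC : xbar ∈ C :=
    hCcomp.isClosed.mem_of_tendsto hlim (Eventually.of_forall fun k => (hxk k).1)
  have hxbar : ∀ z ∈ C, h ybar xbar ≤ h ybar z := by
    intro z hz
    have hle := le_of_tendsto_of_tendsto' (hhx.add (hε.mul (hfx.pow 2)))
      ((hhz z).add (hε.mul ((hfz z).pow 2))) fun k => (hxk k).2 z hz
    simpa using hle
  refine ⟨⟨hxbarC, hxbar⟩, fun z hz => ?_⟩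
  obtain ⟨σ₀, -, hσ⟩ := hHoffman
  -- Points of the sublevel sets `Λ_k` that converge to `z`.
  have hnear (k) : ∃ u ∈ {x | x ∈ C ∧ h (yk k) x ≤ h (yk k) (xk k)},
      dist z u < max (h (yk k) z - h (yk k) (xk k)) 0 / σ₀ + ε k :=
    (Metric.infDist_lt_iff (s := {x | x ∈ C ∧ h (yk k) x ≤ h (yk k) (xk k)})
      ⟨xk k, (hxk k).1, le_rfl⟩).1
      ((hσ k z hz.1).trans_lt (lt_add_of_pos_right _ (hεpos k)))
  choose u hu hdist using hnear
  have heq : h ybar z = h ybar xbar := le_antisymm (hz.2 _ hxbarC) (hxbar z hz.1)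
  have hbound : Tendsto (fun k => max (h (yk k) z - h (yk k) (xk k)) 0 / σ₀ + ε k)
      atTop (𝓝 0) := by
    simpa [heq] using
      ((((hhz z).sub hhx).max (tendsto_const_nhds (x := (0 : ℝ)))).div_const σ₀).add hε
  have hulim : Tendsto u atTop (𝓝 z) := by
    rw [tendsto_iff_dist_tendsto_zero]
    exact squeeze_zero (fun _ => dist_nonneg)
      (fun k => (dist_comm (u k) z).trans_le (hdist k).le) hbound
  have hfu : Tendsto (fun k => f (yk k) (u k)) atTop (𝓝 (f ybar z)) :=
    (hf.tendsto (ybar, z)).comp (hyk.prodMk_nhds hulim)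
  refine le_of_tendsto_of_tendsto' (hfx.pow 2) (hfu.pow 2) fun k => ?_
  refine le_of_mul_le_mul_left ?_ (hεpos k)
  linarith [(hxk k).2 (u k) (hu k).1, (hu k).2]
end

section
/- Let ε_k → 0 with ε_k > 0 and for each k let y_k be an optimal solution of (P_{ε_k}) with x_k ∈ S_{ε_k}(y_k). Assume the Hoffman-type error bound: there exists σ₀ > 0 such that for every sequence (z_k) with z_k ∈ S_{ε_k}(w_k) for some w_k ∈ K converging in K, and every x̃ ∈ C, dist(x̃, {x ∈ C : h(w_k, x) ≤ h(w_k, z_k)}) ≤ max(h(w_k, x̃) − h(w_k, z_k), 0)/σ₀. Then, along a subsequence, y_k → ȳ and x_k → x̄ with ȳ ∈ K, x̄ ∈ S̃(ȳ), and (ȳ, x̄) is an optimal solution of the three-level problem (P̃): f(ỹ, x̃) ≤ f(ȳ, x̄) for every ỹ ∈ K and every x̃ ∈ S̃(ỹ). -/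
open Filter Topology

section

variable {n m : ℕ} {C : Set (EuclideanSpace ℝ (Fin m))}
  {f h : EuclideanSpace ℝ (Fin n) → EuclideanSpace ℝ (Fin m) → ℝ}

theorem Seps_nonempty (hCne : C.Nonempty) (hCcomp : IsCompact C)
    (hf : Continuous fun p : EuclideanSpace ℝ (Fin n) × EuclideanSpace ℝ (Fin m) => f p.1 p.2)
    (hh : Continuous fun p : EuclideanSpace ℝ (Fin n) × EuclideanSpace ℝ (Fin m) => h p.1 p.2)
    (ε : ℝ) (y : EuclideanSpace ℝ (Fin n)) : (Seps C f h ε y).Nonempty := by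
  have hfy : Continuous (f y) := hf.comp (Continuous.prodMk_right y)
  have hhy : Continuous (h y) := hh.comp (Continuous.prodMk_right y)
  obtain ⟨x, hxC, hx⟩ := hCcomp.exists_isMinOn hCne
    (f := fun z => h y z + ε * (f y z) ^ 2) (by fun_prop)
  exact ⟨x, hxC, fun z hz => hx hz⟩

/-- Limits of minimizers of the regularized problems minimize `h`. -/
theorem mem_Slow_of_tendsto {ι : Type*} {l : Filter ι} [l.NeBot] (hCcomp : IsCompact C)
    (hf : Continuous fun p : EuclideanSpace ℝ (Fin n) × EuclideanSpace ℝ (Fin m) => f p.1 p.2)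
    (hh : Continuous fun p : EuclideanSpace ℝ (Fin n) × EuclideanSpace ℝ (Fin m) => h p.1 p.2)
    {ε : ι → ℝ} (hε : Tendsto ε l (𝓝 0))
    {w : ι → EuclideanSpace ℝ (Fin n)} {z : ι → EuclideanSpace ℝ (Fin m)}
    (hz : ∀ k, z k ∈ Seps C f h (ε k) (w k))
    {wbar : EuclideanSpace ℝ (Fin n)} {zbar : EuclideanSpace ℝ (Fin m)}
    (hwlim : Tendsto w l (𝓝 wbar)) (hzlim : Tendsto z l (𝓝 zbar)) :
    zbar ∈ Slow C h wbar := by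
  refine ⟨hCcomp.isClosed.mem_of_tendsto hzlim (.of_forall fun k => (hz k).1), fun u hu => ?_⟩
  have lim : ∀ {v : ι → EuclideanSpace ℝ (Fin m)} {vbar}, Tendsto v l (𝓝 vbar) →
      Tendsto (fun k => h (w k) (v k) + ε k * (f (w k) (v k)) ^ 2) l (𝓝 (h wbar vbar)) := by
    intro v vbar hv
    have hp := hwlim.prodMk_nhds hv
    simpa using ((hh.tendsto (wbar, vbar)).comp hp).add
      (hε.mul (((hf.tendsto (wbar, vbar)).comp hp).pow 2))
  exact le_of_tendsto_of_tendsto' (lim hzlim) (lim tendsto_const_nhds) fun k => (hz k).2 u hu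

/-- Under a uniform error bound for the sublevel sets of `h`, limits of minimizers of the
regularized problems solve the hierarchical problem. -/
theorem mem_Stilde_of_tendsto {ι : Type*} {l : Filter ι} [l.NeBot] (hCcomp : IsCompact C)
    (hf : Continuous fun p : EuclideanSpace ℝ (Fin n) × EuclideanSpace ℝ (Fin m) => f p.1 p.2)
    (hh : Continuous fun p : EuclideanSpace ℝ (Fin n) × EuclideanSpace ℝ (Fin m) => h p.1 p.2)
    {ε : ι → ℝ} (hεpos : ∀ k, 0 < ε k) (hε : Tendsto ε l (𝓝 0))
    {w : ι → EuclideanSpace ℝ (Fin n)} {z : ι → EuclideanSpace ℝ (Fin m)}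
    (hz : ∀ k, z k ∈ Seps C f h (ε k) (w k))
    {wbar : EuclideanSpace ℝ (Fin n)} {zbar : EuclideanSpace ℝ (Fin m)}
    (hwlim : Tendsto w l (𝓝 wbar)) (hzlim : Tendsto z l (𝓝 zbar)) {σ : ℝ}
    (hbound : ∀ k, ∀ u ∈ C, Metric.infDist u {x | x ∈ C ∧ h (w k) x ≤ h (w k) (z k)} ≤
      max (h (w k) u - h (w k) (z k)) 0 / σ) :
    zbar ∈ Stilde C f h wbar := by
  have hzbar := mem_Slow_of_tendsto hCcomp hf hh hε hz hwlim hzlim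
  refine ⟨hzbar, fun u hu => ?_⟩
  have hproj : ∀ k, ∃ v, (v ∈ C ∧ h (w k) v ≤ h (w k) (z k)) ∧
      dist u v ≤ max (h (w k) u - h (w k) (z k)) 0 / σ := by
    intro k
    have hhw : Continuous (h (w k)) := hh.comp (Continuous.prodMk_right (w k))
    have hcomp : IsCompact {x | x ∈ C ∧ h (w k) x ≤ h (w k) (z k)} :=
      hCcomp.inter_right (isClosed_le hhw continuous_const)
    obtain ⟨v, hv, hdist⟩ := hcomp.exists_infDist_eq_dist ⟨z k, (hz k).1, le_rfl⟩ u
    exact ⟨v, hv, hdist ▸ hbound k u hu.1⟩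
  choose v hv hdist using hproj
  have lim : ∀ {g : EuclideanSpace ℝ (Fin n) → EuclideanSpace ℝ (Fin m) → ℝ},
      (Continuous fun p : EuclideanSpace ℝ (Fin n) × EuclideanSpace ℝ (Fin m) => g p.1 p.2) →
      ∀ {v : ι → EuclideanSpace ℝ (Fin m)} {vbar}, Tendsto v l (𝓝 vbar) →
      Tendsto (fun k => g (w k) (v k)) l (𝓝 (g wbar vbar)) := fun hg _ _ hv =>
    (hg.tendsto (wbar, _)).comp (hwlim.prodMk_nhds hv)
  have hgap : h wbar u - h wbar zbar = 0 :=
    sub_eq_zero.2 (le_antisymm (hu.2 zbar hzbar.1) (hzbar.2 u hu.1))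
  have hbound0 : Tendsto (fun k => max (h (w k) u - h (w k) (z k)) 0 / σ) l (𝓝 0) := by
    simpa [hgap] using
      (((lim hh (tendsto_const_nhds (x := u))).sub (lim hh hzlim)).max
        (tendsto_const_nhds (x := (0 : ℝ)))).div_const σ
  have hvlim : Tendsto v l (𝓝 u) := by
    rw [tendsto_iff_dist_tendsto_zero]
    exact squeeze_zero (fun _ => dist_nonneg) (fun k => dist_comm u (v k) ▸ hdist k) hbound0
  refine le_of_tendsto_of_tendsto' ((lim hf hzlim).pow 2) ((lim hf hvlim).pow 2) fun k => ?_
  have hmin := (hz k).2 (v k) (hv k).1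
  exact le_of_mul_le_mul_left (by linarith [(hv k).2]) (hεpos k)

end

theorem stmt8 {n m : ℕ} (K : Set (EuclideanSpace ℝ (Fin n))) (C : Set (EuclideanSpace ℝ (Fin m)))
    (hKne : K.Nonempty) (hKconv : Convex ℝ K) (hKcomp : IsCompact K)
    (hCne : C.Nonempty) (hCconv : Convex ℝ C) (hCcomp : IsCompact C)
    (f h : EuclideanSpace ℝ (Fin n) → EuclideanSpace ℝ (Fin m) → ℝ)
    (hf : Continuous fun p : EuclideanSpace ℝ (Fin n) × EuclideanSpace ℝ (Fin m) => f p.1 p.2)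
    (hh : Continuous fun p : EuclideanSpace ℝ (Fin n) × EuclideanSpace ℝ (Fin m) => h p.1 p.2)
    (hfpos : ∀ y x, 0 ≤ f y x)
    (hfconv : ∀ y ∈ K, ConvexOn ℝ Set.univ (f y))
    (hhconv : ∀ y ∈ K, ConvexOn ℝ Set.univ (h y))
    (ε : ℕ → ℝ) (hεpos : ∀ k, 0 < ε k) (hε : Tendsto ε atTop (𝓝 0))
    (yk : ℕ → EuclideanSpace ℝ (Fin n)) (xk : ℕ → EuclideanSpace ℝ (Fin m))
    (hopt : ∀ k, yk k ∈ K ∧ xk k ∈ Seps C f h (ε k) (yk k) ∧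
      ∀ y ∈ K, ∀ x ∈ Seps C f h (ε k) y, f y x ≤ f (yk k) (xk k))
    (hHoffman : ∃ σ₀ : ℝ, 0 < σ₀ ∧
      ∀ (wk : ℕ → EuclideanSpace ℝ (Fin n)) (zk : ℕ → EuclideanSpace ℝ (Fin m)),
        (∀ k, wk k ∈ K) → (∃ wbar ∈ K, Tendsto wk atTop (𝓝 wbar)) →
        (∀ k, zk k ∈ Seps C f h (ε k) (wk k)) →
        ∀ k, ∀ xt ∈ C,
          Metric.infDist xt {x | x ∈ C ∧ h (wk k) x ≤ h (wk k) (zk k)} ≤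
            max (h (wk k) xt - h (wk k) (zk k)) 0 / σ₀) :
    ∃ (φ : ℕ → ℕ) (ybar : EuclideanSpace ℝ (Fin n)) (xbar : EuclideanSpace ℝ (Fin m)),
      StrictMono φ ∧
      Tendsto (yk ∘ φ) atTop (𝓝 ybar) ∧ Tendsto (xk ∘ φ) atTop (𝓝 xbar) ∧
      ybar ∈ K ∧ xbar ∈ Stilde C f h ybar ∧
      ∀ yt ∈ K, ∀ xt ∈ Stilde C f h yt, f yt xt ≤ f ybar xbar := by
  obtain ⟨σ, -, hσ⟩ := hHoffman
  have hbound : ∀ k, ∀ w ∈ K, ∀ z ∈ Seps C f h (ε k) w, ∀ u ∈ C,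
      Metric.infDist u {x | x ∈ C ∧ h w x ≤ h w z} ≤ max (h w u - h w z) 0 / σ := by
    intro k w hw z hz
    choose s hs using fun j => Seps_nonempty hCne hCcomp hf hh (ε j) w
    have hsel : ∀ j, Function.update s k z j ∈ Seps C f h (ε j) w := by
      intro j
      obtain rfl | hjk := eq_or_ne j k
      · simpa using hz
      · simpa [hjk] using hs j
    simpa using hσ (fun _ => w) (Function.update s k z) (fun _ => hw)
      ⟨w, hw, tendsto_const_nhds⟩ hsel k
  obtain ⟨⟨ybar, xbar⟩, hbar, φ, hφ, hlim⟩ := (hKcomp.prod hCcomp).tendsto_subseq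
    (x := fun k => (yk k, xk k)) fun k => ⟨(hopt k).1, (hopt k).2.1.1⟩
  have hylim : Tendsto (yk ∘ φ) atTop (𝓝 ybar) := (continuous_fst.tendsto _).comp hlim
  have hxlim : Tendsto (xk ∘ φ) atTop (𝓝 xbar) := (continuous_snd.tendsto _).comp hlim
  refine ⟨φ, ybar, xbar, hφ, hylim, hxlim, hbar.1, ?_, fun yt hyt xt hxt => ?_⟩
  · exact mem_Stilde_of_tendsto hCcomp hf hh (fun k => hεpos (φ k))
      (hε.comp hφ.tendsto_atTop) (fun k => (hopt (φ k)).2.1) hylim hxlim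
      fun k => hbound (φ k) _ (hopt (φ k)).1 _ (hopt (φ k)).2.1
  · choose s hs using fun k => Seps_nonempty hCne hCcomp hf hh (ε (φ k)) yt
    obtain ⟨sbar, -, ψ, hψ, hslim⟩ := hCcomp.tendsto_subseq fun k => (hs k).1
    have hsbar : sbar ∈ Stilde C f h yt :=
      mem_Stilde_of_tendsto hCcomp hf hh (fun k => hεpos (φ (ψ k)))
        (hε.comp (hφ.comp hψ).tendsto_atTop) (fun k => hs (ψ k)) tendsto_const_nhds hslim
        fun k => hbound (φ (ψ k)) yt hyt _ (hs (ψ k))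
    have hle : f yt xt ≤ f yt sbar :=
      (sq_le_sq₀ (hfpos _ _) (hfpos _ _)).1 (hxt.2 sbar hsbar.1)
    have hfs : Tendsto (fun k => f yt (s (ψ k))) atTop (𝓝 (f yt sbar)) :=
      (hf.tendsto (yt, sbar)).comp (tendsto_const_nhds.prodMk_nhds hslim)
    have hfx : Tendsto (fun k => f (yk (φ (ψ k))) (xk (φ (ψ k)))) atTop (𝓝 (f ybar xbar)) :=
      (hf.tendsto (ybar, xbar)).comp (hlim.comp hψ.tendsto_atTop)
    exact hle.trans <| le_of_tendsto_of_tendsto' hfs hfx fun k =>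
      (hopt (φ (ψ k))).2.2 yt hyt _ (hs (ψ k))
end

section
/- Let ε > ε' > 0 and y ∈ ℝⁿ. If x_ε ∈ S_ε(y) and x̃ ∈ S_{ε'}(y), then f(y, x_ε)² ≤ f(y, x̃)². -/
open Filter Topology

theorem stmt9 {n m : ℕ} (C : Set (EuclideanSpace ℝ (Fin m)))
    (hCne : C.Nonempty) (hCconv : Convex ℝ C) (hCcomp : IsCompact C)
    (f h : EuclideanSpace ℝ (Fin n) → EuclideanSpace ℝ (Fin m) → ℝ)
    (hf : Continuous fun p : EuclideanSpace ℝ (Fin n) × EuclideanSpace ℝ (Fin m) => f p.1 p.2)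
    (hh : Continuous fun p : EuclideanSpace ℝ (Fin n) × EuclideanSpace ℝ (Fin m) => h p.1 p.2)
    (hfpos : ∀ y x, 0 ≤ f y x)
    (ε ε' : ℝ) (hε' : 0 < ε') (hεε' : ε' < ε)
    (y : EuclideanSpace ℝ (Fin n))
    (xε xt : EuclideanSpace ℝ (Fin m))
    (hxε : xε ∈ Seps C f h ε y) (hxt : xt ∈ Seps C f h ε' y) :
    (f y xε) ^ 2 ≤ (f y xt) ^ 2 := by
  have h₁ := hxε.2 xt hxt.1
  have h₂ := hxt.2 xε hxε.1
  refine le_of_mul_le_mul_left ?_ (sub_pos.2 hεε')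
  linarith
end

section
/- Let ε > ε' > 0. Let y_ε be an optimal solution of (P_ε) with x_ε ∈ S_ε(y_ε), and y_{ε'} an optimal solution of (P_{ε'}) with x_{ε'} ∈ S_{ε'}(y_{ε'}). Then f(y_ε, x_ε) ≤ f(y_{ε'}, x_{ε'}); that is, the optimal value of (P_ε) is nondecreasing as ε decreases. -/
open Filter Topology

theorem nonempty_Seps {n m : ℕ} {C : Set (EuclideanSpace ℝ (Fin m))}
    (hCne : C.Nonempty) (hCcomp : IsCompact C)
    {f h : EuclideanSpace ℝ (Fin n) → EuclideanSpace ℝ (Fin m) → ℝ}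
    {y : EuclideanSpace ℝ (Fin n)} (hf : Continuous (f y)) (hh : Continuous (h y)) (ε : ℝ) :
    (Seps C f h ε y).Nonempty := by
  obtain ⟨x, hxC, hx⟩ := hCcomp.exists_isMinOn hCne
    (f := fun z => h y z + ε * (f y z) ^ 2) (by fun_prop)
  exact ⟨x, hxC, fun z hz => hx hz⟩

/-- Along the argmin sets, `f y` is antitone in the penalty parameter. -/
theorem le_of_mem_Seps {n m : ℕ} {C : Set (EuclideanSpace ℝ (Fin m))}
    {f h : EuclideanSpace ℝ (Fin n) → EuclideanSpace ℝ (Fin m) → ℝ}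
    {y : EuclideanSpace ℝ (Fin n)} (hfpos : ∀ x, 0 ≤ f y x) {ε ε' : ℝ} (hεε' : ε' < ε)
    {x x' : EuclideanSpace ℝ (Fin m)} (hx : x ∈ Seps C f h ε y) (hx' : x' ∈ Seps C f h ε' y) :
    f y x ≤ f y x' := by
  have h₁ := hx.2 x' hx'.1
  have h₂ := hx'.2 x hx.1
  refine (sq_le_sq₀ (hfpos x) (hfpos x')).1 ?_
  exact le_of_mul_le_mul_left (by linarith) (sub_pos.2 hεε')

theorem stmt10 {n m : ℕ} (K : Set (EuclideanSpace ℝ (Fin n))) (C : Set (EuclideanSpace ℝ (Fin m)))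
    (hKne : K.Nonempty) (hKconv : Convex ℝ K) (hKcomp : IsCompact K)
    (hCne : C.Nonempty) (hCconv : Convex ℝ C) (hCcomp : IsCompact C)
    (f h : EuclideanSpace ℝ (Fin n) → EuclideanSpace ℝ (Fin m) → ℝ)
    (hf : Continuous fun p : EuclideanSpace ℝ (Fin n) × EuclideanSpace ℝ (Fin m) => f p.1 p.2)
    (hh : Continuous fun p : EuclideanSpace ℝ (Fin n) × EuclideanSpace ℝ (Fin m) => h p.1 p.2)
    (hfpos : ∀ y x, 0 ≤ f y x)
    (ε ε' : ℝ) (hε' : 0 < ε') (hεε' : ε' < ε)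
    (yε yε' : EuclideanSpace ℝ (Fin n)) (xε xε' : EuclideanSpace ℝ (Fin m))
    (hyεK : yε ∈ K) (hxε : xε ∈ Seps C f h ε yε)
    (hoptε : ∀ y ∈ K, ∀ x ∈ Seps C f h ε y, f y x ≤ f yε xε)
    (hyε'K : yε' ∈ K) (hxε' : xε' ∈ Seps C f h ε' yε')
    (hoptε' : ∀ y ∈ K, ∀ x ∈ Seps C f h ε' y, f y x ≤ f yε' xε') :
    f yε xε ≤ f yε' xε' := by
  have hf' : Continuous (f yε) := hf.comp (Continuous.prodMk_right yε)
  have hh' : Continuous (h yε) := hh.comp (Continuous.prodMk_right yε)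
  obtain ⟨x, hx⟩ := nonempty_Seps hCne hCcomp hf' hh' ε'
  exact (le_of_mem_Seps (hfpos yε) hεε' hxε hx).trans (hoptε' yε hyεK x hx)
end

section
/- Let ε_k → 0 with ε_k > 0, let y* ∈ ℝⁿ, let x̃_k ∈ S_{ε_k}(y*) for every k, and suppose there are γ > 0 and points x*_k ∈ C* with ‖x̃_k − x*_k‖ ≤ γ ε_k for all k. Then (x̃_k) has a subsequence converging to some x̄ ∈ S̃(y*), and along that subsequence x*_k converges to the same limit x̄. -/
open Filter Topology

/-- Every point of `C` that does at least as well as some `x ∈ S̃(y)` in both objectives lies in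
`S̃(y)`. -/
theorem mem_Stilde_of_le {n m : ℕ} {C : Set (EuclideanSpace ℝ (Fin m))}
    {f h : EuclideanSpace ℝ (Fin n) → EuclideanSpace ℝ (Fin m) → ℝ}
    {y : EuclideanSpace ℝ (Fin n)} {x x' : EuclideanSpace ℝ (Fin m)}
    (hx : x ∈ Stilde C f h y) (hx' : x' ∈ C) (hle : h y x' ≤ h y x)
    (hfpos : 0 ≤ f y x') (hfle : f y x' ≤ f y x) : x' ∈ Stilde C f h y :=
  ⟨⟨hx', fun z hz => hle.trans (hx.1.2 z hz)⟩,
    fun z hz => (pow_le_pow_left₀ hfpos hfle 2).trans (hx.2 z hz)⟩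

theorem stmt15 {n m : ℕ} (C : Set (EuclideanSpace ℝ (Fin m)))
    (hCne : C.Nonempty) (hCconv : Convex ℝ C) (hCcomp : IsCompact C)
    (f h : EuclideanSpace ℝ (Fin n) → EuclideanSpace ℝ (Fin m) → ℝ)
    (hf : Continuous fun p : EuclideanSpace ℝ (Fin n) × EuclideanSpace ℝ (Fin m) => f p.1 p.2)
    (hh : Continuous fun p : EuclideanSpace ℝ (Fin n) × EuclideanSpace ℝ (Fin m) => h p.1 p.2)
    (hfpos : ∀ y x, 0 ≤ f y x)
    (ystar : EuclideanSpace ℝ (Fin n)) (xstar : EuclideanSpace ℝ (Fin m))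
    (hxstar : xstar ∈ Stilde C f h ystar)
    (ε : ℕ → ℝ) (hεpos : ∀ k, 0 < ε k) (hε : Tendsto ε atTop (𝓝 0))
    (xt : ℕ → EuclideanSpace ℝ (Fin m)) (hxt : ∀ k, xt k ∈ Seps C f h (ε k) ystar)
    (xs : ℕ → EuclideanSpace ℝ (Fin m))
    (hxs : ∀ k, xs k ∈ {x | x ∈ C ∧ h ystar x ≤ h ystar xstar ∧ f ystar x ≤ f ystar xstar})
    (γ : ℝ) (hγ : 0 < γ) (hclose : ∀ k, ‖xt k - xs k‖ ≤ γ * ε k) :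
    ∃ (φ : ℕ → ℕ) (xbar : EuclideanSpace ℝ (Fin m)), StrictMono φ ∧
      xbar ∈ Stilde C f h ystar ∧
      Tendsto (xt ∘ φ) atTop (𝓝 xbar) ∧ Tendsto (xs ∘ φ) atTop (𝓝 xbar) := by
  have hfc : Continuous (f ystar) := hf.comp (Continuous.prodMk_right ystar)
  have hhc : Continuous (h ystar) := hh.comp (Continuous.prodMk_right ystar)
  have hcomp : IsCompact
      {x | x ∈ C ∧ h ystar x ≤ h ystar xstar ∧ f ystar x ≤ f ystar xstar} :=
    hCcomp.inter_right ((isClosed_le hhc continuous_const).inter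
      (isClosed_le hfc continuous_const))
  obtain ⟨xbar, ⟨hC, hhle, hfle⟩, φ, hφ, hlim⟩ := hcomp.tendsto_subseq hxs
  have hdiff : Tendsto (fun k => xt k - xs k) atTop (𝓝 0) :=
    squeeze_zero_norm hclose (by simpa using hε.const_mul γ)
  refine ⟨φ, xbar, hφ, mem_Stilde_of_le hxstar hC hhle (hfpos _ _) hfle, ?_, hlim⟩
  simpa [Function.comp_def] using (hdiff.comp hφ.tendsto_atTop).add hlim
end

section
/- (Theorem 4.1, upper-level estimate.) Assume β* > 0. Let ε_k → 0 with ε_k > 0, let y_k be an optimal solution of (P_{ε_k}) with x_k ∈ S_{ε_k}(y_k), and let x̃_k ∈ S_{ε_k}(y*). Assume the sandwich inequalities f(y*, x̃_k) ≤ f(y_k, x_k) ≤ β* for all k, and assume (f(y*, x̃_k)² − β*²)/ε_k → 0. Then (β* − f(y_k, x_k))/ε_k → 0; i.e. f(y*, x*) − f(y_ε, x_ε) = o(ε). -/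
open Filter Topology

theorem stmt17 {n m : ℕ} (K : Set (EuclideanSpace ℝ (Fin n))) (C : Set (EuclideanSpace ℝ (Fin m)))
    (hKne : K.Nonempty) (hKconv : Convex ℝ K) (hKcomp : IsCompact K)
    (hCne : C.Nonempty) (hCconv : Convex ℝ C) (hCcomp : IsCompact C)
    (f h : EuclideanSpace ℝ (Fin n) → EuclideanSpace ℝ (Fin m) → ℝ)
    (hf : Continuous fun p : EuclideanSpace ℝ (Fin n) × EuclideanSpace ℝ (Fin m) => f p.1 p.2)
    (hh : Continuous fun p : EuclideanSpace ℝ (Fin n) × EuclideanSpace ℝ (Fin m) => h p.1 p.2)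
    (hfpos : ∀ y x, 0 ≤ f y x)
    (ystar : EuclideanSpace ℝ (Fin n)) (hystar : ystar ∈ K)
    (xstar : EuclideanSpace ℝ (Fin m)) (hxstar : xstar ∈ Stilde C f h ystar)
    (hβpos : 0 < f ystar xstar)
    (ε : ℕ → ℝ) (hεpos : ∀ k, 0 < ε k) (hε : Tendsto ε atTop (𝓝 0))
    (yk : ℕ → EuclideanSpace ℝ (Fin n)) (xk : ℕ → EuclideanSpace ℝ (Fin m))
    (hopt : ∀ k, yk k ∈ K ∧ xk k ∈ Seps C f h (ε k) (yk k) ∧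
      ∀ y ∈ K, ∀ x ∈ Seps C f h (ε k) y, f y x ≤ f (yk k) (xk k))
    (xt : ℕ → EuclideanSpace ℝ (Fin m)) (hxt : ∀ k, xt k ∈ Seps C f h (ε k) ystar)
    (hsandwich : ∀ k, f ystar (xt k) ≤ f (yk k) (xk k) ∧ f (yk k) (xk k) ≤ f ystar xstar)
    (hfsq : Tendsto (fun k => ((f ystar (xt k)) ^ 2 - (f ystar xstar) ^ 2) / ε k) atTop (𝓝 0)) :
    Tendsto (fun k => (f ystar xstar - f (yk k) (xk k)) / ε k) atTop (𝓝 0) := by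
  have hbound : Tendsto (fun k => -(((f ystar (xt k)) ^ 2 - (f ystar xstar) ^ 2) / ε k) / f ystar xstar)
      atTop (𝓝 0) := by
    simpa using hfsq.neg.div_const (f ystar xstar)
  refine squeeze_zero (fun k => div_nonneg (sub_nonneg.2 (hsandwich k).2) (hεpos k).le)
    (fun k => ?_) hbound
  obtain ⟨hlow, hup⟩ := hsandwich k
  rw [← neg_div, div_right_comm]
  refine div_le_div_of_nonneg_right ?_ (hεpos k).le
  rw [le_div_iff₀ hβpos]
  nlinarith [mul_nonneg (sub_nonneg.2 (hlow.trans hup)) (hfpos ystar (xt k)),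
    mul_nonneg (sub_nonneg.2 hlow) hβpos.le]
end
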